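/- For every real ε ≠ 0 one has P(1/8, ε) = (9/512)(9ε⁴ + 96ε³ − 560ε² + 256ε + 64), and for ε ∈ (0, 1] one has P(1/8, ε) = 0 if and only if ε = ε̂ := (2/3)(3√6 − 2√(16 − 6√6) − 4). Moreover, writing w₁(ε) < w₂(ε) < w₃(ε) for the three real roots of z ↦ P(z, ε) when 0 < ε < 1, the middle root satisfies w₂(ε) ∈ (1/8, 1/2) for 0 < ε < ε̂ and w₂(ε) ∈ (0, 1/8) for ε̂ < ε < 1, with w₂(ε̂) = 1/8. -/

import Mathlib

/-- The cubic polynomial `P(z, ε)`. -/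
def Pcub (z ε : ℝ) : ℝ :=
  (ε ^ 4 + 16 * ε ^ 2 + 64) * z ^ 3
    + (2 * ε ^ 4 - 20 * ε ^ 3 - 24 * ε ^ 2 + 160 * ε - 64) * z ^ 2
    + (ε ^ 4 - 16 * ε ^ 3 + 84 * ε ^ 2 - 112 * ε + 16) * z
    + ε * (4 * ε ^ 2 - 20 * ε + 16)

/-- The constant `ε̂ = (2/3)(3√6 − 2√(16 − 6√6) − 4) ≈ 0.7103`. -/
noncomputable def epsHat : ℝ :=
  2 / 3 * (3 * Real.sqrt 6 - 2 * Real.sqrt (16 - 6 * Real.sqrt 6) - 4)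

/-- Vieta's formulas for a real cubic with three distinct roots. -/
theorem cubic_vieta {a b c d x y z : ℝ} (hxy : x ≠ y) (hyz : y ≠ z) (hxz : x ≠ z)
    (hx : a * x ^ 3 + b * x ^ 2 + c * x + d = 0)
    (hy : a * y ^ 3 + b * y ^ 2 + c * y + d = 0)
    (hz : a * z ^ 3 + b * z ^ 2 + c * z + d = 0) :
    b = -(a * (x + y + z)) ∧ c = a * (x * y + x * z + y * z) ∧ d = -(a * (x * y * z)) := by
  have h1 : a * (x ^ 2 + x * y + y ^ 2) + b * (x + y) + c = 0 := by
    apply mul_left_cancel₀ (sub_ne_zero.mpr hxy)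
    linear_combination hx - hy
  have h2 : a * (y ^ 2 + y * z + z ^ 2) + b * (y + z) + c = 0 := by
    apply mul_left_cancel₀ (sub_ne_zero.mpr hyz)
    linear_combination hy - hz
  have hb : b = -(a * (x + y + z)) := by
    apply mul_left_cancel₀ (sub_ne_zero.mpr hxz)
    linear_combination h1 - h2
  have hc : c = a * (x * y + x * z + y * z) := by
    linear_combination h1 - (x + y) * hb
  refine ⟨hb, hc, ?_⟩
  linear_combination hx - x ^ 2 * hb - x * hc

theorem Pcub_one_eighth (ε : ℝ) :
    Pcub (1 / 8) ε = 9 / 512 * (9 * ε ^ 4 + 96 * ε ^ 3 - 560 * ε ^ 2 + 256 * ε + 64) := by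
  unfold Pcub
  ring

/-- On `(0, 1]`, `P(1/8, ε)` is a positive multiple of `ε̂ - ε`. -/
theorem exists_pos_Pcub_one_eighth_eq_mul {ε : ℝ} (h0 : 0 < ε) (h1 : ε ≤ 1) :
    ∃ k : ℝ, 0 < k ∧ Pcub (1 / 8) ε = k * (epsHat - ε) := by
  set s := √6 with hs
  set t := √(16 - 6 * s) with ht
  have hs2 : s ^ 2 = 6 := Real.sq_sqrt (by norm_num)
  have hs0 : 0 ≤ s := Real.sqrt_nonneg _
  have hs_lower : 12 / 5 < s := by nlinarith
  have hs_upper : s < 5 / 2 := by nlinarith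
  have ht2 : t ^ 2 = 16 - 6 * s := Real.sq_sqrt (by linarith)
  have ht0 : 0 ≤ t := Real.sqrt_nonneg _
  have hε : epsHat = 2 / 3 * (3 * s - 2 * t - 4) := rfl
  have hl : 0 < 2 / 3 * (3 * s + 2 * t - 4) - ε := by linarith
  have hr : 0 < 3 * ε ^ 2 + (16 + 12 * s) * ε + 8 := by positivity
  refine ⟨9 / 512 * (3 * ((2 / 3 * (3 * s + 2 * t - 4) - ε) *
    (3 * ε ^ 2 + (16 + 12 * s) * ε + 8))), by positivity, ?_⟩
  have hA : 3 * ((2 / 3 * (3 * s + 2 * t - 4) - ε) * (epsHat - ε)) =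
      3 * ε ^ 2 + (16 - 12 * s) * ε + 8 := by
    rw [hε]
    linear_combination 12 * hs2 - 16 / 3 * ht2
  rw [Pcub_one_eighth]
  linear_combination (-9 / 512) * (3 * ε ^ 2 + (16 + 12 * s) * ε + 8) * hA
    + 9 / 512 * 144 * ε ^ 2 * hs2

/-- For `0 < ε < 1`, `P(·, ε)` factors over its three real roots `w₁ < w₂ < w₃`, which satisfy
`w₁ < 0 < w₂ < 1 / 2` and `1 / 8 < w₃`. -/
theorem Pcub_roots_location {ε : ℝ} (h0 : 0 < ε) (h1 : ε < 1) {w₁ w₂ w₃ : ℝ}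
    (h12 : w₁ < w₂) (h23 : w₂ < w₃)
    (hw₁ : Pcub w₁ ε = 0) (hw₂ : Pcub w₂ ε = 0) (hw₃ : Pcub w₃ ε = 0) :
    (∃ a : ℝ, 0 < a ∧ ∀ z, Pcub z ε = a * ((z - w₁) * ((z - w₂) * (z - w₃)))) ∧
      w₁ < 0 ∧ 0 < w₂ ∧ w₂ < 1 / 2 ∧ 1 / 8 < w₃ := by
  obtain ⟨hb, hc, hd⟩ := cubic_vieta h12.ne h23.ne (h12.trans h23).ne hw₁ hw₂ hw₃
  have ha : 0 < ε ^ 4 + 16 * ε ^ 2 + 64 := by positivity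
  have hε2 : ε ^ 2 < 1 := by nlinarith
  have hε2' : 0 < ε ^ 2 := by positivity
  have hε3' : 0 < ε ^ 3 := by positivity
  have hε4' : 0 < ε ^ 4 := by positivity
  have hε3 : ε ^ 3 < ε ^ 2 := by nlinarith
  have hε4 : ε ^ 4 < ε ^ 3 := by nlinarith
  have hprod_neg : -(ε * (4 * ε ^ 2 - 20 * ε + 16)) < 0 := by
    have : 0 < ε * ((1 - ε) * (4 - ε)) := by
      have := sub_pos.mpr h1
      have : 0 < 4 - ε := by linarith
      positivity
    linarith
  have hcoeff : 2 * ε ^ 4 - 20 * ε ^ 3 - 24 * ε ^ 2 + 160 * ε - 64 < 0 ∨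
      ε ^ 4 - 16 * ε ^ 3 + 84 * ε ^ 2 - 112 * ε + 16 < 0 := by
    rcases le_or_gt ε (3 / 10) with h | h
    · left; nlinarith
    · right; nlinarith
  have heighth : 3 / 8 * (ε ^ 4 + 16 * ε ^ 2 + 64)
        + (2 * ε ^ 4 - 20 * ε ^ 3 - 24 * ε ^ 2 + 160 * ε - 64) < 0 ∨
      3 / 64 * (ε ^ 4 + 16 * ε ^ 2 + 64)
        + 1 / 4 * (2 * ε ^ 4 - 20 * ε ^ 3 - 24 * ε ^ 2 + 160 * ε - 64)
        + (ε ^ 4 - 16 * ε ^ 3 + 84 * ε ^ 2 - 112 * ε + 16) < 0 := by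
    rcases le_or_gt ε (1 / 10) with h | h
    · left; nlinarith
    · right; nlinarith
  have hhalf₁ : 0 < 3 / 4 * (ε ^ 4 + 16 * ε ^ 2 + 64)
        + (2 * ε ^ 4 - 20 * ε ^ 3 - 24 * ε ^ 2 + 160 * ε - 64)
        + (ε ^ 4 - 16 * ε ^ 3 + 84 * ε ^ 2 - 112 * ε + 16) := by nlinarith
  have hhalf₂ : 0 < 3 / 2 * (ε ^ 4 + 16 * ε ^ 2 + 64)
        + (2 * ε ^ 4 - 20 * ε ^ 3 - 24 * ε ^ 2 + 160 * ε - 64) := by nlinarith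
  have hhalf₀ : 0 < Pcub (1 / 2) ε := by
    have hP : Pcub (1 / 2) ε = 9 / 8 * (ε * (4 - ε)) ^ 2 := by unfold Pcub; ring
    have : 0 < 4 - ε := by linarith
    rw [hP]
    positivity
  have hfac : ∀ z, Pcub z ε =
      (ε ^ 4 + 16 * ε ^ 2 + 64) * ((z - w₁) * ((z - w₂) * (z - w₃))) := by
    intro z
    unfold Pcub
    linear_combination z ^ 2 * hb + z * hc + hd
  rw [hfac] at hhalf₀
  rw [hd] at hprod_neg
  rw [hb, hc] at hcoeff heighth hhalf₁
  rw [hb] at hhalf₂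
  generalize ε ^ 4 + 16 * ε ^ 2 + 64 = a at *
  have hprod : w₁ * (w₂ * w₃) < 0 := by
    by_contra! h
    have := mul_nonneg ha.le h
    linarith
  have hw₁0 : w₁ < 0 := by
    by_contra! h
    have : 0 ≤ w₁ * (w₂ * w₃) :=
      mul_nonneg h (mul_nonneg (by linarith) (by linarith))
    linarith
  have h23pos : 0 < w₂ * w₃ := pos_of_mul_neg_right hprod hw₁0.le
  have hw₂0 : 0 < w₂ := by
    by_contra! h
    have hw₂' : w₂ < 0 := lt_of_le_of_ne h (by rintro rfl; simp at h23pos)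
    have hw₃' : w₃ < 0 := by
      by_contra! h
      linarith [mul_nonpos_of_nonpos_of_nonneg hw₂'.le h]
    rcases hcoeff with h | h
    · have := mul_pos ha (show 0 < -(w₁ + w₂ + w₃) by linarith)
      linarith
    · have := mul_pos_of_neg_of_neg hw₁0 hw₂'
      have := mul_pos_of_neg_of_neg hw₁0 hw₃'
      have := mul_pos ha (show 0 < w₁ * w₂ + w₁ * w₃ + w₂ * w₃ by linarith)
      linarith
  refine ⟨⟨a, ha, hfac⟩, hw₁0, hw₂0, ?_, ?_⟩
  · by_contra! h
    have hx : 0 < 1 / 2 - w₁ := by linarith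
    have hy : 0 ≤ w₂ - 1 / 2 := by linarith
    have hz : 0 ≤ w₃ - 1 / 2 := by linarith
    have e₂ : 0 < (1 / 2 - w₁) - (w₂ - 1 / 2) - (w₃ - 1 / 2) := by
      refine pos_of_mul_pos_right (a := a) ?_ ha.le
      linarith
    have e₁ : 0 < (w₂ - 1 / 2) * (w₃ - 1 / 2)
        - (1 / 2 - w₁) * ((w₂ - 1 / 2) + (w₃ - 1 / 2)) := by
      refine pos_of_mul_pos_right (a := a) ?_ ha.le
      linarith
    nlinarith [mul_nonneg hy hz, mul_nonneg e₂.le (add_nonneg hy hz)]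
  · by_contra! h
    have hx : 0 < 1 / 8 - w₁ := by linarith
    have hy : 0 < 1 / 8 - w₂ := by linarith
    have hz : 0 ≤ 1 / 8 - w₃ := by linarith
    rcases heighth with e | e
    · have := mul_pos ha (show 0 < (1 / 8 - w₁) + (1 / 8 - w₂) + (1 / 8 - w₃) by linarith)
      linarith
    · have := mul_pos ha (show 0 < (1 / 8 - w₁) * (1 / 8 - w₂)
        + (1 / 8 - w₁) * (1 / 8 - w₃) + (1 / 8 - w₂) * (1 / 8 - w₃) by positivity)
      linarith


/-- `P(1/8, ε) = (9/512)(9ε⁴ + 96ε³ − 560ε² + 256ε + 64)` for `ε ≠ 0`; for `ε ∈ (0, 1]`,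
`P(1/8, ε) = 0` iff `ε = ε̂`; and for `0 < ε < 1`, writing `w₁ < w₂ < w₃` for the three
real roots of `z ↦ P(z, ε)`, the middle root satisfies `w₂ ∈ (1/8, 1/2)` for `ε < ε̂`,
`w₂ ∈ (0, 1/8)` for `ε̂ < ε`, and `w₂ = 1/8` for `ε = ε̂`. -/
theorem Pcub_middle_root :
    (∀ ε : ℝ, ε ≠ 0 →
      Pcub (1 / 8) ε = 9 / 512 * (9 * ε ^ 4 + 96 * ε ^ 3 - 560 * ε ^ 2 + 256 * ε + 64)) ∧
    (∀ ε : ℝ, 0 < ε → ε ≤ 1 → (Pcub (1 / 8) ε = 0 ↔ ε = epsHat)) ∧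
    (∀ ε : ℝ, 0 < ε → ε < 1 → ∀ w₁ w₂ w₃ : ℝ, w₁ < w₂ → w₂ < w₃ →
      Pcub w₁ ε = 0 → Pcub w₂ ε = 0 → Pcub w₃ ε = 0 →
      (ε < epsHat → 1 / 8 < w₂ ∧ w₂ < 1 / 2) ∧
      (epsHat < ε → 0 < w₂ ∧ w₂ < 1 / 8) ∧
      (ε = epsHat → w₂ = 1 / 8)) := by
  refine ⟨fun ε _ => Pcub_one_eighth ε, fun ε h0 h1 => ?_, ?_⟩
  · obtain ⟨k, hk, hP⟩ := exists_pos_Pcub_one_eighth_eq_mul h0 h1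
    rw [hP, mul_eq_zero, sub_eq_zero, or_iff_right hk.ne', eq_comm]
  · intro ε h0 h1 w₁ w₂ w₃ h12 h23 hw₁ hw₂ hw₃
    obtain ⟨k, hk, hP⟩ := exists_pos_Pcub_one_eighth_eq_mul h0 h1.le
    obtain ⟨⟨a, ha, hfac⟩, hw₁0, hw₂0, hw₂_lt, hw₃_gt⟩ :=
      Pcub_roots_location h0 h1 h12 h23 hw₁ hw₂ hw₃
    have hc : 0 < a * ((1 / 8 - w₁) * (w₃ - 1 / 8)) :=
      mul_pos ha (mul_pos (by linarith) (by linarith))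
    have key : k * (epsHat - ε) = a * ((1 / 8 - w₁) * (w₃ - 1 / 8)) * (w₂ - 1 / 8) := by
      rw [← hP, hfac]
      ring
    refine ⟨fun h => ⟨?_, hw₂_lt⟩, fun h => ⟨hw₂0, ?_⟩, fun h => ?_⟩
    · have := mul_pos hk (sub_pos.mpr h)
      rw [key] at this
      exact sub_pos.mp (pos_of_mul_pos_right this hc.le)
    · have := mul_neg_of_pos_of_neg hk (sub_neg.mpr h)
      rw [key] at this
      exact sub_neg.mp (neg_of_mul_neg_right this hc.le)
    · rw [h, sub_self, mul_zero, eq_comm, mul_eq_zero, or_iff_right hc.ne'] at key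
      exact sub_eq_zero.mp key
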